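/- The detection-to-conflict dual update monotonically increases the dual function: let u ∈ V_det be a detection node with conf(u) nonempty and let λ ∈ Λ. Define the update μ ∈ Λ by μ(e) = (1/|conf(u)|) · min{⟨θ^λ_u, x⟩ : x ∈ X_u, x_det = 1} for every e ∈ conf(u), with all other components of μ equal to zero. Then D(λ) ≤ D(λ + μ). -/

import Mathlib

open Finset

/-- Transition edges: a move `u→v` is `Sum.inl (u, v)`, a division `u→(v, w)` is
`Sum.inr (u, v, w)`. -/
abbrev Edge (Vdet : Type*) := (Vdet × Vdet) ⊕ (Vdet × Vdet × Vdet)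

/-- A detection state `(x_det, x_in, x_out)`: the activation flag is a `Bool`, and each
`{0,1}`-vector is identified with the finite set of coordinates equal to `1`. -/
abbrev DetS (Vdet : Type*) := Bool × Finset (Edge Vdet) × Finset (Edge Vdet)

/-- A tracking decomposition: detection nodes `Vdet`, conflict nodes `Vconf`,
move edges (with distinct endpoints), division edges (with pairwise distinct nodes)
and conflict edges. -/
structure Tracking (Vdet Vconf : Type*) [Fintype Vdet] [DecidableEq Vdet]
    [Fintype Vconf] [DecidableEq Vconf] where
  Emove : Finset (Vdet × Vdet)
  Ediv : Finset (Vdet × Vdet × Vdet)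
  Econf : Finset (Vdet × Vconf)
  move_ne : ∀ e ∈ Emove, e.1 ≠ e.2
  div_ne : ∀ e ∈ Ediv, e.1 ≠ e.2.1 ∧ e.1 ≠ e.2.2 ∧ e.2.1 ≠ e.2.2

/-- A cost vector `θ`. -/
structure Cost (Vdet Vconf : Type*) where
  det : Vdet → ℝ
  inn : Vdet → Edge Vdet → ℝ
  out : Vdet → Edge Vdet → ℝ
  conf : Vconf → Vdet → ℝ

/-- A reparametrization `λ ∈ Λ`: one real per move edge, a pair of reals
`(λ_v(e), λ_w(e))` per division edge `e = u→(v,w)`, and one real per conflict edge. -/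
abbrev Repa (Vdet Vconf : Type*) : Type _ :=
  ((Vdet × Vdet) → ℝ) × ((Vdet × Vdet × Vdet) → ℝ × ℝ) × ((Vdet × Vconf) → ℝ)

variable {Vdet Vconf : Type*} [Fintype Vdet] [DecidableEq Vdet]
  [Fintype Vconf] [DecidableEq Vconf]

namespace Tracking

variable (T : Tracking Vdet Vconf)

/-- The set `In(u)` of incoming transition edges of a detection node `u`. -/
def In (u : Vdet) : Finset (Edge Vdet) :=
  (T.Emove.filter (fun m => m.2 = u)).image Sum.inl ∪
    (T.Ediv.filter (fun d => d.2.1 = u ∨ d.2.2 = u)).image Sum.inr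

/-- The set `Out(u)` of outgoing transition edges of a detection node `u`. -/
def Out (u : Vdet) : Finset (Edge Vdet) :=
  (T.Emove.filter (fun m => m.1 = u)).image Sum.inl ∪
    (T.Ediv.filter (fun d => d.1 = u)).image Sum.inr

/-- The set `conf(u)` of conflict edges incident to a detection node `u`. -/
def confSet (u : Vdet) : Finset (Vdet × Vconf) := T.Econf.filter (fun e => e.1 = u)

/-- The detection nodes `u ∈ c` of a conflict node `c`. -/
def membersOf (c : Vconf) : Finset Vdet := Finset.univ.filter (fun v => (v, c) ∈ T.Econf)

/-- The state space `X_u` of a detection node. -/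
def XDet (u : Vdet) : Finset (DetS Vdet) :=
  Finset.univ.filter (fun s =>
    s.2.1 ⊆ T.In u ∧ s.2.2 ⊆ T.Out u ∧
    s.2.1.card ≤ (if s.1 then 1 else 0) ∧ s.2.2.card ≤ (if s.1 then 1 else 0))

lemma zero_mem_XDet (u : Vdet) : ((false, ∅, ∅) : DetS Vdet) ∈ T.XDet u := by
  simp [XDet]

lemma XDet_nonempty (u : Vdet) : (T.XDet u).Nonempty := ⟨_, T.zero_mem_XDet u⟩

/-- The state space `X_c` of a conflict node. -/
def XConf (c : Vconf) : Finset (Finset Vdet) :=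
  Finset.univ.filter (fun s => (∀ v ∈ s, (v, c) ∈ T.Econf) ∧ s.card ≤ 1)

lemma empty_mem_XConf (c : Vconf) : (∅ : Finset Vdet) ∈ T.XConf c := by
  simp [XConf]

lemma XConf_nonempty (c : Vconf) : (T.XConf c).Nonempty := ⟨_, T.empty_mem_XConf c⟩

end Tracking

/-- The cost `⟨θ_u, x_u⟩` of a detection state. -/
def detCost (θ : Cost Vdet Vconf) (u : Vdet) (s : DetS Vdet) : ℝ :=
  (if s.1 then θ.det u else 0) + ∑ e ∈ s.2.1, θ.inn u e + ∑ e ∈ s.2.2, θ.out u e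

/-- The cost `⟨θ_c, x_c⟩` of a conflict state. -/
def confCost (θ : Cost Vdet Vconf) (c : Vconf) (s : Finset Vdet) : ℝ :=
  ∑ v ∈ s, θ.conf c v

/-- The energy `E(θ, x)`. -/
def energy (θ : Cost Vdet Vconf) (x : Vdet → DetS Vdet) (y : Vconf → Finset Vdet) : ℝ :=
  ∑ u, detCost θ u (x u) + ∑ c, confCost θ c (y c)

namespace Tracking

variable (T : Tracking Vdet Vconf)

/-- The coupling constraints relating the states of the nodes. -/
def Coupled (x : Vdet → DetS Vdet) (y : Vconf → Finset Vdet) : Prop :=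
  (∀ m ∈ T.Emove, (Sum.inl m ∈ (x m.1).2.2 ↔ Sum.inl m ∈ (x m.2).2.1)) ∧
  (∀ d ∈ T.Ediv, (Sum.inr d ∈ (x d.1).2.2 ↔ Sum.inr d ∈ (x d.2.1).2.1) ∧
      (Sum.inr d ∈ (x d.1).2.2 ↔ Sum.inr d ∈ (x d.2.2).2.1)) ∧
  (∀ e ∈ T.Econf, ((x e.1).1 = true ↔ e.1 ∈ y e.2))

/-- A feasible assignment `x ∈ X`: valid local states satisfying all coupling constraints. -/
def Feasible (x : Vdet → DetS Vdet) (y : Vconf → Finset Vdet) : Prop :=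
  (∀ u, x u ∈ T.XDet u) ∧ (∀ c, y c ∈ T.XConf c) ∧ T.Coupled x y

/-- The reparametrized costs `θ^λ`. -/
def repaCost (θ : Cost Vdet Vconf) (l : Repa Vdet Vconf) : Cost Vdet Vconf where
  det u := θ.det u - ∑ e ∈ T.confSet u, l.2.2 e
  inn u e := θ.inn u e +
    (match e with
      | Sum.inl m => l.1 m
      | Sum.inr d =>
          (if d.2.1 = u then (l.2.1 d).1 else 0) + (if d.2.2 = u then (l.2.1 d).2 else 0))
  out u e := θ.out u e -
    (match e with
      | Sum.inl m => l.1 m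
      | Sum.inr d => (l.2.1 d).1 + (l.2.1 d).2)
  conf c u := θ.conf c u + l.2.2 (u, c)

/-- The dual function `D(λ)`. -/
def D (θ : Cost Vdet Vconf) (l : Repa Vdet Vconf) : ℝ :=
  ∑ u, (T.XDet u).inf' (T.XDet_nonempty u) (detCost (T.repaCost θ l) u) +
    ∑ c, (T.XConf c).inf' (T.XConf_nonempty c) (confCost (T.repaCost θ l) c)

/-- The states of `X_u` with active detection variable, `{x ∈ X_u : x_det = 1}`. -/
def XDet1 (u : Vdet) : Finset (DetS Vdet) := (T.XDet u).filter (fun s => s.1 = true)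

lemma one_mem_XDet1 (u : Vdet) : ((true, ∅, ∅) : DetS Vdet) ∈ T.XDet1 u := by
  simp [XDet1, XDet]

lemma XDet1_nonempty (u : Vdet) : (T.XDet1 u).Nonempty := ⟨_, T.one_mem_XDet1 u⟩

/-- The states of `X_u` with a given active outgoing edge, `{x ∈ X_u : x_out(e) = 1}`. -/
def XDetOut (u : Vdet) (e : Edge Vdet) : Finset (DetS Vdet) :=
  (T.XDet u).filter (fun s => e ∈ s.2.2)

lemma XDetOut_nonempty (u : Vdet) (e : Edge Vdet) (he : e ∈ T.Out u) :
    (T.XDetOut u e).Nonempty :=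
  ⟨(true, ∅, {e}), by simp [XDetOut, XDet, Finset.singleton_subset_iff, he]⟩

/-- The states of `X_u` with a given active incoming edge, `{x ∈ X_u : x_in(e) = 1}`. -/
def XDetIn (u : Vdet) (e : Edge Vdet) : Finset (DetS Vdet) :=
  (T.XDet u).filter (fun s => e ∈ s.2.1)

lemma XDetIn_nonempty (u : Vdet) (e : Edge Vdet) (he : e ∈ T.In u) :
    (T.XDetIn u e).Nonempty :=
  ⟨(true, {e}, ∅), by simp [XDetIn, XDet, Finset.singleton_subset_iff, he]⟩

/-- `min{⟨θ_u, x⟩ : x ∈ X_u, x_out(e) = 1}` (by convention `0` if `e ∉ Out(u)`). -/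
def minOutOn (θ : Cost Vdet Vconf) (u : Vdet) (e : Edge Vdet) : ℝ :=
  if h : e ∈ T.Out u then (T.XDetOut u e).inf' (T.XDetOut_nonempty u e h) (detCost θ u) else 0

/-- `min{⟨θ_u, x⟩ : x ∈ X_u, x_in(e) = 1}` (by convention `0` if `e ∉ In(u)`). -/
def minInOn (θ : Cost Vdet Vconf) (u : Vdet) (e : Edge Vdet) : ℝ :=
  if h : e ∈ T.In u then (T.XDetIn u e).inf' (T.XDetIn_nonempty u e h) (detCost θ u) else 0

end Tracking

/-- The detection-to-conflict dual update monotonically increases the dual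
function: for `u ∈ V_det` with `conf(u)` nonempty, the update `μ` with
`μ(e) = (1/|conf(u)|) · min{⟨θ^λ_u, x⟩ : x ∈ X_u, x_det = 1}` for every `e ∈ conf(u)` (all
other components zero) satisfies `D(λ) ≤ D(λ + μ)`. -/
theorem det_to_conf_update_monotone {Vdet Vconf : Type*} [Fintype Vdet] [DecidableEq Vdet]
    [Fintype Vconf] [DecidableEq Vconf] (T : Tracking Vdet Vconf) (θ : Cost Vdet Vconf)
    (l : Repa Vdet Vconf) (u : Vdet) (hu : (T.confSet u).Nonempty)
    (μ : Repa Vdet Vconf)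
    (hμmove : μ.1 = 0) (hμdiv : μ.2.1 = 0)
    (hμconf : ∀ e : Vdet × Vconf, μ.2.2 e =
      if e ∈ T.confSet u then
        (1 / (T.confSet u).card : ℝ) *
          (T.XDet1 u).inf' (T.XDet1_nonempty u) (detCost (T.repaCost θ l) u)
      else 0) :
    T.D θ l ≤ T.D θ (l + μ) := by
  classical
  set m := (T.XDet1 u).inf' (T.XDet1_nonempty u) (detCost (T.repaCost θ l) u) with hm
  set n : ℝ := ((T.confSet u).card : ℝ) with hn
  have hnpos : 0 < n := by
    rw [hn]; exact_mod_cast hu.card_pos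
  have hinn : (T.repaCost θ (l + μ)).inn = (T.repaCost θ l).inn := by
    funext v e
    rcases e with e | e <;> simp [Tracking.repaCost, hμmove, hμdiv]
  have hout : (T.repaCost θ (l + μ)).out = (T.repaCost θ l).out := by
    funext v e
    rcases e with e | e <;> simp [Tracking.repaCost, hμmove, hμdiv]
  have hsum : ∀ v, ∑ e ∈ T.confSet v, μ.2.2 e = if v = u then m else 0 := by
    intro v
    split_ifs with h
    · subst h
      rw [Finset.sum_congr rfl (fun e he => by rw [hμconf e, if_pos he])]
      rw [Finset.sum_const, nsmul_eq_mul]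
      change n * (1 / n * m) = m
      field_simp
    · apply Finset.sum_eq_zero
      intro e he
      rw [hμconf e, if_neg]
      intro he'
      simp only [Tracking.confSet, Finset.mem_filter] at he he'
      exact h (he.2.symm.trans he'.2)
  have hdet : ∀ v, (T.repaCost θ (l + μ)).det v =
      (T.repaCost θ l).det v - if v = u then m else 0 := by
    intro v
    rw [← hsum v]
    simp only [Tracking.repaCost, Prod.snd_add, Pi.add_apply, Finset.sum_add_distrib]
    ring
  have hcost : ∀ v s, detCost (T.repaCost θ (l + μ)) v s =
      detCost (T.repaCost θ l) v s - if s.1 = true ∧ v = u then m else 0 := by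
    intro v s
    unfold detCost
    rw [hinn, hout, hdet]
    by_cases h1 : s.1 = true <;> by_cases h2 : v = u <;> simp [h1, h2] <;> ring
  have h1 : ∀ v, (T.XDet v).inf' (T.XDet_nonempty v) (detCost (T.repaCost θ l) v)
      - (if v = u then min 0 m else 0) ≤
      (T.XDet v).inf' (T.XDet_nonempty v) (detCost (T.repaCost θ (l + μ)) v) := by
    intro v
    apply Finset.le_inf'
    intro s hs
    rw [hcost]
    by_cases h2 : v = u
    · subst h2
      have hA : (T.XDet v).inf' (T.XDet_nonempty v) (detCost (T.repaCost θ l) v) ≤ min 0 m := by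
        apply le_min
        · refine (Finset.inf'_le _ (T.zero_mem_XDet v)).trans ?_
          simp [detCost]
        · rw [hm]
          apply Finset.le_inf'
          intro t ht
          exact Finset.inf'_le _ (Finset.mem_filter.1 ht).1
      have hB : 0 ≤ detCost (T.repaCost θ l) v s - if s.1 = true ∧ v = v then m else 0 := by
        by_cases h3 : s.1 = true
        · have : m ≤ detCost (T.repaCost θ l) v s :=
            Finset.inf'_le _ (Finset.mem_filter.2 ⟨hs, h3⟩)
          simp [h3, this]
        · simp only [Tracking.XDet, Finset.mem_filter] at hs
          obtain ⟨_, _, _, ha, hb⟩ := hs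
          simp [h3] at ha hb
          simp [detCost, h3, ha, hb]
      rw [if_pos rfl]
      linarith
    · simp only [h2, and_false, if_false]
      have := Finset.inf'_le (detCost (T.repaCost θ l) v) hs
      linarith
  have h2 : ∀ c, (T.XConf c).inf' (T.XConf_nonempty c) (confCost (T.repaCost θ l) c)
      + (if (u, c) ∈ T.Econf then 1 / n * min 0 m else 0) ≤
      (T.XConf c).inf' (T.XConf_nonempty c) (confCost (T.repaCost θ (l + μ)) c) := by
    intro c
    apply Finset.le_inf'
    intro s hs
    have hA := Finset.inf'_le (confCost (T.repaCost θ l) c) hs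
    have hB : confCost (T.repaCost θ (l + μ)) c s =
        confCost (T.repaCost θ l) c s + ∑ v ∈ s, μ.2.2 (v, c) := by
      simp only [confCost, Tracking.repaCost, Prod.snd_add, Pi.add_apply,
        Finset.sum_add_distrib]
      ring
    have hC : ∑ v ∈ s, μ.2.2 (v, c) =
        if u ∈ s then (if (u, c) ∈ T.Econf then 1 / n * m else 0) else 0 := by
      rw [← Finset.sum_ite_eq' s u (fun _ => if (u, c) ∈ T.Econf then 1 / n * m else 0)]
      apply Finset.sum_congr rfl
      intro v _
      rw [hμconf]
      by_cases hv : v = u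
      · subst hv; simp [Tracking.confSet]
      · simp [Tracking.confSet, hv]
    have hp : 0 ≤ 1 / n := by positivity
    have i1 : 1 / n * min 0 m ≤ 1 / n * m := mul_le_mul_of_nonneg_left (min_le_right _ _) hp
    have i2 : 1 / n * min 0 m ≤ 0 := mul_nonpos_of_nonneg_of_nonpos hp (min_le_left _ _)
    rw [hB, hC]
    split_ifs <;> linarith
  have h3 : ∑ c : Vconf, (if (u, c) ∈ T.Econf then 1 / n * min 0 m else 0) = min 0 m := by
    rw [← Finset.sum_filter, Finset.sum_const, nsmul_eq_mul]
    have : (Finset.univ.filter (fun c => (u, c) ∈ T.Econf)).card = (T.confSet u).card := by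
      apply Finset.card_bij (fun c _ => (u, c))
      · intro c hc; simpa [Tracking.confSet] using hc
      · intro a _ b _ h; simpa using h
      · rintro ⟨a, b⟩ h
        simp only [Tracking.confSet, Finset.mem_filter] at h
        obtain ⟨h, rfl⟩ := h
        exact ⟨b, by simpa using h, rfl⟩
    rw [this]
    change n * (1 / n * min 0 m) = min 0 m
    field_simp
  have s1 := Finset.sum_le_sum (s := Finset.univ) (fun v _ => h1 v)
  have s2 := Finset.sum_le_sum (s := Finset.univ) (fun c _ => h2 c)
  rw [Finset.sum_sub_distrib, Finset.sum_ite_eq' Finset.univ u] at s1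
  rw [Finset.sum_add_distrib, h3] at s2
  simp only [Finset.mem_univ, if_true] at s1
  unfold Tracking.D
  linarith
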